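/- arXiv:math/0601247 — 2 statements merged into one kernel-verified Lean document; each statement's English description precedes it below -/
import Mathlib

section
/- Assume (A3). Let q be a point parallel to p with q ≠ p, and let x ∈ P ∖ p̄. Then there exists a circle Q with x ∈ Q such that Q ∖ p̄ is exactly the set of all points z at which some circle of the pencil ⟨p,K⟩ is tangent to some circle containing both q and x (i.e., z is a point with M ∩ N = {z} for some M ∈ ⟨p,K⟩ and some circle N with q, x ∈ N). -/
/-- A Laguerre plane: points, circles, and a parallelity relation. -/
structure LaguerrePlane (P : Type*) where
  Circles : Set (Set P)
  Par : P → P → Prop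
  par_equiv : Equivalence Par
  joinCircle : ∀ a b c : P, ¬ Par a b → ¬ Par b c → ¬ Par a c →
    ∃! C, C ∈ Circles ∧ a ∈ C ∧ b ∈ C ∧ c ∈ C
  touching : ∀ K ∈ Circles, ∀ p ∈ K, ∀ q, q ∉ K → ¬ Par p q →
    ∃! C, C ∈ Circles ∧ q ∈ C ∧ K ∩ C = {p}
  parPoint : ∀ (x : P), ∀ K ∈ Circles, ∃! q, Par x q ∧ q ∈ K
  nontriv : ∃ C ∈ Circles,
    (∃ a b c : P, a ∈ C ∧ b ∈ C ∧ c ∈ C ∧ a ≠ b ∧ b ≠ c ∧ a ≠ c) ∧ C ≠ Set.univ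

namespace LaguerrePlane

variable {P : Type*}

/-- The generator (parallel class) of a point. -/
def gen (L : LaguerrePlane P) (p : P) : Set P := {q | L.Par p q}

/-- The pencil ⟨p,K⟩: the circle K together with all circles tangent to K at p. -/
def pencil (L : LaguerrePlane P) (p : P) (K : Set P) : Set (Set P) :=
  insert K {M | M ∈ L.Circles ∧ M ∩ K = {p}}

/-- An automorphism of a Laguerre plane: a bijection of the points mapping
circles onto circles and preserving parallelity. -/
def IsAut (L : LaguerrePlane P) (σ : Equiv.Perm P) : Prop :=
  (∀ C, C ∈ L.Circles ↔ ⇑σ '' C ∈ L.Circles) ∧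
  (∀ x y, L.Par x y ↔ L.Par (σ x) (σ y))

/-- The line x ⊔ y of the residual plane SA(p,K):
{x} together with the orbit of y under the stabilizer of x in Δ. -/
def line (Δ : Subgroup (Equiv.Perm P)) (x y : P) : Set P :=
  {x} ∪ {z | ∃ σ ∈ Δ, σ x = x ∧ σ y = z}

/-- Parallelity of lines of the residual plane SA(p,K). -/
def LinePar (Δ : Subgroup (Equiv.Perm P)) (A B : Set P) : Prop :=
  ∃ σ ∈ Δ, ⇑σ '' A = B

end LaguerrePlane

open LaguerrePlane

namespace LaguerrePlane

variable {P : Type*} {L : LaguerrePlane P} {p : P} {K : Set P}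

theorem eq_of_par {C : Set P} (hC : C ∈ L.Circles) {a b : P} (ha : a ∈ C) (hb : b ∈ C)
    (h : L.Par a b) : a = b :=
  (L.parPoint a C hC).unique ⟨L.par_equiv.refl a, ha⟩ ⟨h, hb⟩

theorem not_par_of_ne {C : Set P} (hC : C ∈ L.Circles) {a b : P} (ha : a ∈ C) (hb : b ∈ C)
    (h : a ≠ b) : ¬ L.Par a b :=
  fun hab => h (eq_of_par hC ha hb hab)

theorem circle_of_mem_pencil (hK : K ∈ L.Circles) {M : Set P} (hM : M ∈ L.pencil p K) :
    M ∈ L.Circles := by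
  rcases hM with rfl | hM
  exacts [hK, hM.1]

theorem mem_of_mem_pencil (hpK : p ∈ K) {M : Set P} (hM : M ∈ L.pencil p K) : p ∈ M := by
  rcases hM with rfl | hM
  · exact hpK
  · exact (hM.2.symm.subset rfl).1

theorem pencil_unique (hK : K ∈ L.Circles) (hpK : p ∈ K) {M N : Set P}
    (hM : M ∈ L.pencil p K) (hN : N ∈ L.pencil p K) {x : P} (hxM : x ∈ M) (hxN : x ∈ N)
    (hx : ¬ L.Par p x) : M = N := by
  have hxp : x ≠ p := fun h => hx (h ▸ L.par_equiv.refl x)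
  have key : ∀ M' ∈ L.pencil p K, x ∈ M' → x ∈ K → M' = K := by
    rintro M' (rfl | hM') hxM' hxK
    · rfl
    · exact absurd (hM'.2.subset ⟨hxM', hxK⟩) hxp
  by_cases hxK : x ∈ K
  · rw [key M hM hxM hxK, key N hN hxN hxK]
  · rcases hM with rfl | hM
    · exact absurd hxM hxK
    rcases hN with rfl | hN
    · exact absurd hxN hxK
    exact (L.touching K hK p hpK x hxK hx).unique ⟨hM.1, hxM, by rw [Set.inter_comm, hM.2]⟩
      ⟨hN.1, hxN, by rw [Set.inter_comm, hN.2]⟩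

/-- Some point lies on neither of two given generators. -/
theorem exists_not_par (L : LaguerrePlane P) (a b : P) : ∃ w, ¬ L.Par a w ∧ ¬ L.Par b w := by
  obtain ⟨C, hC, ⟨u, v, w, hu, hv, hw, huv, hvw, huw⟩, -⟩ := L.nontriv
  have key : ∀ c s t, s ∈ C → t ∈ C → s ≠ t → L.Par c s → ¬ L.Par c t :=
    fun c s t hs ht hst h1 h2 => hst (eq_of_par hC hs ht
      (L.par_equiv.trans (L.par_equiv.symm h1) h2))
  have hua := key a u v hu hv huv
  have hub := key b u v hu hv huv
  have hva := key a v w hv hw hvw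
  have hvb := key b v w hv hw hvw
  have hwa := key a u w hu hw huw
  have hwb := key b u w hu hw huw
  by_contra! h
  have h1 := h u
  have h2 := h v
  have h3 := h w
  tauto

end LaguerrePlane

/-- assume (A3).  For q parallel to p, q ≠ p, and x ∈ P ∖ p̄, the
points of tangency of circles of ⟨p,K⟩ with circles through q and x form a
circle (minus its point on p̄) through x. -/
theorem tangency_points_form_circle
    {P : Type*} (L : LaguerrePlane P) (p : P) (K : Set P)
    (Δ : Subgroup (Equiv.Perm P))
    (hK : K ∈ L.Circles) (hpK : p ∈ K)
    (haut : ∀ σ ∈ Δ, L.IsAut σ)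
    (hfix : ∀ σ ∈ Δ, ∀ q, L.Par p q → σ q = q)
    (hpen : ∀ σ ∈ Δ, ∀ M ∈ L.pencil p K, ⇑σ '' M ∈ L.pencil p K)
    (hA1 : ∀ x y : P, ¬ L.Par p x → ¬ L.Par p y → ∃ σ ∈ Δ, σ x = y)
    (hA2 : ∀ r ∈ K, r ≠ p → ∀ x ∈ K, x ≠ p → x ≠ r → ∀ y ∈ K, y ≠ p → y ≠ r →
      ∃ σ ∈ Δ, σ r = r ∧ σ x = y)    (hA3 : ∀ M ∈ L.Circles, p ∉ M → ∃! N, N ∈ L.pencil p K ∧ ∃ z, M ∩ N = {z})    :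
    ∀ q : P, L.Par p q → q ≠ p → ∀ x : P, ¬ L.Par p x →
    ∃ Q ∈ L.Circles, x ∈ Q ∧
      Q \ L.gen p =
        {z | ∃ M ∈ L.pencil p K, ∃ N ∈ L.Circles,
          q ∈ N ∧ x ∈ N ∧ M ∩ N = {z}} := by
  intro q hq hqp x hx
  have psymm : ∀ {a b}, L.Par a b → L.Par b a := fun h => L.par_equiv.symm h
  have ptrans : ∀ {a b c}, L.Par a b → L.Par b c → L.Par a c := fun h h' => L.par_equiv.trans h h'
  have hpp := L.par_equiv.refl p
  have hσC : ∀ σ ∈ Δ, ∀ C ∈ L.Circles, ⇑σ '' C ∈ L.Circles :=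
    fun σ hσ C hC => ((haut σ hσ).1 C).1 hC
  have hxp : x ≠ p := fun h => hx (h ▸ hpp)
  -- the circle of the pencil through `x`
  obtain ⟨r, ⟨hxr, hrK⟩, -⟩ := L.parPoint x K hK
  have hpr : ¬ L.Par p r := fun h => hx (ptrans h (psymm hxr))
  have hrp : r ≠ p := fun h => hpr (h ▸ hpp)
  obtain ⟨τ, hτ, hτr⟩ := hA1 r x hpr hx
  obtain ⟨H, hH⟩ : ∃ H, H = ⇑τ '' K := ⟨_, rfl⟩
  have hHpen : H ∈ L.pencil p K := hH ▸ hpen τ hτ K (Or.inl rfl)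
  have hHC := circle_of_mem_pencil hK hHpen
  have hpH := mem_of_mem_pencil hpK hHpen
  have hxH : x ∈ H := hH ▸ ⟨r, hrK, hτr⟩
  have htrans : ∀ a ∈ H, a ≠ p → a ≠ x → ∀ b ∈ H, b ≠ p → b ≠ x →
      ∃ σ ∈ Δ, σ x = x ∧ σ a = b := by
    rw [hH]
    rintro _ ⟨a, ha, rfl⟩ hap hax _ ⟨b, hb, rfl⟩ hbp hbx
    have hne : ∀ c, τ c ≠ p → τ c ≠ x → c ≠ p ∧ c ≠ r := fun c h1 h2 =>
      ⟨fun h => h1 (by rw [h, hfix τ hτ p hpp]), fun h => h2 (by rw [h, hτr])⟩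
    obtain ⟨σ, hσ, hσr, hσa⟩ := hA2 r hrK hrp a ha (hne a hap hax).1 (hne a hap hax).2
      b hb (hne b hbp hbx).1 (hne b hbp hbx).2
    refine ⟨τ * σ * τ⁻¹, Δ.mul_mem (Δ.mul_mem hτ hσ) (Δ.inv_mem hτ), ?_, ?_⟩
    · simp [← hτr, hσr]
    · simp [hσa]
  have hσH : ∀ σ ∈ Δ, σ x = x → ⇑σ '' H = H := fun σ hσ hσx =>
    pencil_unique hK hpK (hpen σ hσ H hHpen) hHpen ⟨x, hxH, hσx⟩ hxH hx
  have hpnot : ∀ N ∈ L.Circles, q ∈ N → p ∉ N := fun N hN hqN hpN =>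
    hqp (eq_of_par hN hqN hpN (psymm hq))
  have hqx : ¬ L.Par q x := fun h => hx (ptrans hq h)
  have htan : ∀ M ∈ L.pencil p K, ∀ N ∈ L.Circles, q ∈ N → ∀ z, M ∩ N = {z} →
      ¬ L.Par p z := by
    intro M hM N hN hqN z hz hpz
    have hzMN : z ∈ M ∩ N := hz.symm.subset rfl
    have := eq_of_par (circle_of_mem_pencil hK hM) (mem_of_mem_pencil hpK hM) hzMN.1 hpz
    exact hpnot N hN hqN (this ▸ hzMN.2)
  -- a circle through `q` and `x` that is not tangent to `H`
  obtain ⟨w, hpw, hxw⟩ := L.exists_not_par p x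
  obtain ⟨y, ⟨hwy, hyH⟩, -⟩ := L.parPoint w H hHC
  have hpy : ¬ L.Par p y := fun h => hpw (ptrans h (psymm hwy))
  have hyp : y ≠ p := fun h => hpy (h ▸ hpp)
  have hyx : y ≠ x := fun h => hxw (h ▸ psymm hwy)
  have hjoin : ∀ y ∈ H, y ≠ x → y ≠ p → ∃! C, C ∈ L.Circles ∧ q ∈ C ∧ x ∈ C ∧ y ∈ C := by
    intro y hyH hyx hyp
    exact L.joinCircle q x y hqx (not_par_of_ne hHC hxH hyH hyx.symm)
      (fun h => hyp (eq_of_par hHC hyH hpH (psymm (ptrans hq h))))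
  obtain ⟨N, ⟨hN, hqN, hxN, hyN⟩, -⟩ := hjoin y hyH hyx hyp
  obtain ⟨M, ⟨hM, z, hMz⟩, -⟩ := hA3 N hN (hpnot N hN hqN)
  have hzN : z ∈ N := (hMz.symm.subset rfl).1
  have hzM : z ∈ M := (hMz.symm.subset rfl).2
  have hzx : z ≠ x := by
    rintro rfl
    have := pencil_unique hK hpK hM hHpen hzM hxH hx
    exact hyx (hMz.subset ⟨hyN, this ▸ hyH⟩)
  have hpz : ¬ L.Par p z := htan M hM N hN hqN z (by rw [Set.inter_comm, hMz])
  have hzH : z ∉ H := by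
    intro hzH
    have := pencil_unique hK hpK hM hHpen hzM hzH hpz
    exact hzx (hMz.subset ⟨hxN, this ▸ hxH⟩ : x = z).symm
  have hxz : ¬ L.Par x z := not_par_of_ne hN hxN hzN hzx.symm
  -- the circle through `z` tangent to `H` at `x`
  obtain ⟨Q, ⟨hQ, hzQ, hHQ⟩, -⟩ := L.touching H hHC x hxH z hzH hxz
  have hxQ : x ∈ Q := (hHQ.symm.subset rfl).2
  obtain ⟨s, ⟨hps, hsQ⟩, -⟩ := L.parPoint p Q hQ
  have hxs : ¬ L.Par x s := fun h => hx (ptrans hps (psymm h))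
  have hsH : s ∉ H := fun h => hxs ((hHQ.subset ⟨h, hsQ⟩ : s = x) ▸ L.par_equiv.refl s)
  have hσQ : ∀ σ ∈ Δ, σ x = x → ⇑σ '' Q = Q := by
    intro σ hσ hσx
    refine (L.touching H hHC x hxH s hsH hxs).unique
      ⟨hσC σ hσ Q hQ, ⟨s, hsQ, hfix σ hσ s hps⟩, ?_⟩ ⟨hQ, hsQ, hHQ⟩
    nth_rewrite 1 [← hσH σ hσ hσx]
    rw [← Set.image_inter σ.injective, hHQ, Set.image_singleton, hσx]
  refine ⟨Q, hQ, hxQ, Set.Subset.antisymm ?_ ?_⟩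
  · rintro w ⟨hwQ, hpw⟩
    replace hpw : ¬ L.Par p w := hpw
    by_cases hwx : w = x
    · have hqH : q ∉ H := fun h => hqp (eq_of_par hHC h hpH (psymm hq))
      obtain ⟨N', ⟨hN', hqN', hHN'⟩, -⟩ := L.touching H hHC x hxH q hqH (fun h => hqx (psymm h))
      exact ⟨H, hHpen, N', hN', hqN', (hHN'.symm.subset rfl).2, by rw [hHN', hwx]⟩
    · obtain ⟨a, ⟨hza, haH⟩, -⟩ := L.parPoint z H hHC
      obtain ⟨b, ⟨hwb, hbH⟩, -⟩ := L.parPoint w H hHC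
      obtain ⟨σ, hσ, hσx, hσa⟩ := htrans a haH
        (fun h => hpz (psymm (h ▸ hza))) (fun h => hxz (psymm (h ▸ hza))) b hbH
        (fun h => hpw (psymm (h ▸ hwb)))
        (fun h => hwx (eq_of_par hQ hwQ hxQ (h ▸ hwb)))
      have hσz : σ z = w := by
        refine eq_of_par hQ (hσQ σ hσ hσx ▸ ⟨z, hzQ, rfl⟩) hwQ (ptrans (b := b) ?_ (psymm hwb))
        exact hσa ▸ ((haut σ hσ).2 z a).1 hza
      refine ⟨⇑σ '' M, hpen σ hσ M hM, ⇑σ '' N, hσC σ hσ N hN, ⟨q, hqN, hfix σ hσ q hq⟩,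
        ⟨x, hxN, hσx⟩, ?_⟩
      rw [← Set.image_inter σ.injective, Set.inter_comm, hMz, Set.image_singleton, hσz]
  · rintro w ⟨M', hM', N', hN', hqN', hxN', hw⟩
    refine ⟨?_, htan M' hM' N' hN' hqN' w hw⟩
    by_cases hwx : w = x
    · exact hwx ▸ hxQ
    have hpN' := hpnot N' hN' hqN'
    obtain ⟨y', hy'N, hy'H, hy'x⟩ : ∃ y' ∈ N', y' ∈ H ∧ y' ≠ x := by
      by_contra! h
      have hxT : N' ∩ H = {x} :=
        Set.Subset.antisymm (fun t ht => h t ht.1 ht.2) (by rintro _ rfl; exact ⟨hxN', hxH⟩)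
      have hMH : M' = H := (hA3 N' hN' hpN').unique ⟨hM', w, by rw [Set.inter_comm, hw]⟩
        ⟨hHpen, x, hxT⟩
      rw [hMH, Set.inter_comm, hxT] at hw
      exact hwx (Set.singleton_injective hw).symm
    have hy'p : y' ≠ p := fun h => hpN' (h ▸ hy'N)
    obtain ⟨σ, hσ, hσx, hσy⟩ := htrans y hyH hyp hyx y' hy'H hy'p hy'x
    have hσN : ⇑σ '' N = N' := (hjoin y' hy'H hy'x hy'p).unique
      ⟨hσC σ hσ N hN, ⟨q, hqN, hfix σ hσ q hq⟩, ⟨x, hxN, hσx⟩, ⟨y, hyN, hσy⟩⟩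
      ⟨hN', hqN', hxN', hy'N⟩
    have hσNM : N' ∩ ⇑σ '' M = {σ z} := by
      rw [← hσN, ← Set.image_inter σ.injective, hMz, Set.image_singleton]
    have hσM : ⇑σ '' M = M' := (hA3 N' hN' hpN').unique ⟨hpen σ hσ M hM, _, hσNM⟩
      ⟨hM', w, by rw [Set.inter_comm, hw]⟩
    rw [hσM, Set.inter_comm, hw] at hσNM
    rw [Set.singleton_injective hσNM, ← hσQ σ hσ hσx]
    exact ⟨z, hzQ, rfl⟩
end

section
/- Suppose the Laguerre plane is such that every pencil ⟨p′,K′⟩ admits a transitive strain group and satisfies (A3) (as holds in miquelian Laguerre planes of characteristic different from 2). Let x, y be nonparallel points and L a circle with x ∉ L and y ∉ L. Then the following are equivalent: (1) there are exactly two circles containing both x and y that are tangent to L; (2) every circle through x tangent to L and every circle through y tangent to L have a common point; (3) there exist two circles tangent to L at distinct points, containing x and y respectively, that have a common point. -/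
open LaguerrePlane

/-- a ≡_C b : every circle through a tangent to C meets every circle through b
tangent to C. -/
def tangentEquiv {P : Type*} (L : LaguerrePlane P) (C : Set P) (a b : P) :
    Prop :=
  ∀ M ∈ L.Circles, ∀ N ∈ L.Circles, a ∈ M → b ∈ N →
    (∃ z, M ∩ C = {z}) → (∃ z, N ∩ C = {z}) → (M ∩ N).Nonempty

namespace LaguerrePlane

variable {P : Type*} {L : LaguerrePlane P}

theorem par_refl (x : P) : L.Par x x := L.par_equiv.refl x

theorem Par.symm {x y : P} (h : L.Par x y) : L.Par y x := L.par_equiv.symm h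

theorem Par.trans {x y z : P} (h : L.Par x y) (h' : L.Par y z) : L.Par x z :=
  L.par_equiv.trans h h'

theorem eq_of_par_s19 {K : Set P} (hK : K ∈ L.Circles) {x y : P} (hx : x ∈ K) (hy : y ∈ K)
    (h : L.Par x y) : x = y :=
  (L.parPoint x K hK).unique ⟨par_refl x, hx⟩ ⟨h, hy⟩

/-- Two circles with three common points coincide. -/
theorem eq_of_three {K M : Set P} (hK : K ∈ L.Circles) (hM : M ∈ L.Circles) {x y z : P}
    (hxy : x ≠ y) (hyz : y ≠ z) (hxz : x ≠ z) (hx : x ∈ K) (hy : y ∈ K) (hz : z ∈ K)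
    (hx' : x ∈ M) (hy' : y ∈ M) (hz' : z ∈ M) : K = M :=
  (L.joinCircle x y z (fun h => hxy (eq_of_par_s19 hK hx hy h))
    (fun h => hyz (eq_of_par_s19 hK hy hz h)) (fun h => hxz (eq_of_par_s19 hK hx hz h))).unique
    ⟨hK, hx, hy, hz⟩ ⟨hM, hx', hy', hz'⟩

/-- `M` is a circle meeting `C` exactly in `b`. -/
def TangentAt (L : LaguerrePlane P) (C : Set P) (b : P) (M : Set P) : Prop :=
  M ∈ L.Circles ∧ M ∩ C = {b}

namespace TangentAt

variable {C M N : Set P} {b c z : P}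

theorem mem (h : L.TangentAt C b M) : b ∈ M :=
  (h.2.symm ▸ Set.mem_singleton b : b ∈ M ∩ C).1

theorem mem_base (h : L.TangentAt C b M) : b ∈ C :=
  (h.2.symm ▸ Set.mem_singleton b : b ∈ M ∩ C).2

theorem eq_of_mem (h : L.TangentAt C b M) (hz : z ∈ M) (hC : z ∈ C) : z = b := by
  have : z ∈ M ∩ C := ⟨hz, hC⟩
  rwa [h.2] at this

theorem point_unique (h : L.TangentAt C b M) (h' : L.TangentAt C c M) : b = c :=
  h'.eq_of_mem h.mem h.mem_base

theorem not_par (h : L.TangentAt C b M) (hz : z ∈ M) (hC : z ∉ C) : ¬ L.Par b z := fun hp =>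
  hC (eq_of_par_s19 h.1 h.mem hz hp ▸ h.mem_base)

theorem unique (hC : C ∈ L.Circles) (h : L.TangentAt C b M) (h' : L.TangentAt C b N)
    (hz : z ∈ M) (hz' : z ∈ N) (hzC : z ∉ C) : M = N :=
  (L.touching C hC b h.mem_base z hzC (h.not_par hz hzC)).unique
    ⟨h.1, hz, by rw [Set.inter_comm]; exact h.2⟩ ⟨h'.1, hz', by rw [Set.inter_comm]; exact h'.2⟩

end TangentAt

theorem exists_tangentAt {C : Set P} (hC : C ∈ L.Circles) {b z : P} (hb : b ∈ C) (hz : z ∉ C)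
    (h : ¬ L.Par b z) : ∃ M, L.TangentAt C b M ∧ z ∈ M := by
  obtain ⟨M, ⟨hM, hzM, hi⟩, -⟩ := L.touching C hC b hb z hz h
  exact ⟨M, ⟨hM, by rw [Set.inter_comm]; exact hi⟩, hzM⟩

/-- Condition (A3) for all pencils. -/
def UniqueTangents (L : LaguerrePlane P) : Prop :=
  ∀ (p : P) (K : Set P), K ∈ L.Circles → p ∈ K →
    ∀ M ∈ L.Circles, p ∉ M → ∃! N, N ∈ L.pencil p K ∧ ∃ z, M ∩ N = {z}

/-- Circles tangent to `C` at distinct points which meet once meet twice. -/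
theorem UniqueTangents.exists_second (hA : L.UniqueTangents) {C M N : Set P}
    (hC : C ∈ L.Circles) {b c q : P} (hM : L.TangentAt C b M) (hN : L.TangentAt C c N)
    (hbc : b ≠ c) (hqM : q ∈ M) (hqN : q ∈ N) : ∃ y, y ≠ q ∧ y ∈ M ∧ y ∈ N := by
  by_contra! hcon
  have hq : q ∉ C := fun h => hbc ((hM.eq_of_mem hqM h).symm.trans (hN.eq_of_mem hqN h))
  have hi : N ∩ M = {q} := by
    ext z
    refine ⟨fun hz => ?_, ?_⟩
    · by_contra hne
      exact hcon z hne hz.2 hz.1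
    · rintro rfl
      exact ⟨hqN, hqM⟩
  have hMN : M = N := (hA q M hM.1 hqM C hC hq).unique
    ⟨Set.mem_insert _ _, b, by rw [Set.inter_comm]; exact hM.2⟩
    ⟨Set.mem_insert_of_mem _ ⟨hN.1, hi⟩, c, by rw [Set.inter_comm]; exact hN.2⟩
  subst hMN
  exact hbc (hM.point_unique hN)

/-- A group of automorphisms fixing the generator of `a` pointwise, preserving the circle `C`,
and doubly transitive on `C ∖ {a}`. -/
structure IsStrainStabilizer (L : LaguerrePlane P) (a : P) (C : Set P)
    (G : Subgroup (Equiv.Perm P)) : Prop where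
  circle_mem : C ∈ L.Circles
  point_mem : a ∈ C
  aut : ∀ σ ∈ G, L.IsAut σ
  fix : ∀ σ ∈ G, ∀ q, L.Par a q → σ q = q
  image_eq : ∀ σ ∈ G, ⇑σ '' C = C
  trans : ∀ r ∈ C, ∀ u ∈ C, ∀ s ∈ C, ∀ v ∈ C, r ≠ a → u ≠ a → s ≠ a → v ≠ a →
    r ≠ u → s ≠ v → ∃ σ ∈ G, σ r = s ∧ σ u = v

/-- Every pencil admits a transitive strain group. -/
def HasStrains (L : LaguerrePlane P) : Prop :=
  ∀ (p : P) (K : Set P), K ∈ L.Circles → p ∈ K →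
    ∃ Δ : Subgroup (Equiv.Perm P),
      (∀ σ ∈ Δ, L.IsAut σ) ∧
      (∀ σ ∈ Δ, ∀ q, L.Par p q → σ q = q) ∧
      (∀ σ ∈ Δ, ∀ M ∈ L.pencil p K, ⇑σ '' M ∈ L.pencil p K) ∧
      (∀ x y : P, ¬ L.Par p x → ¬ L.Par p y → ∃ σ ∈ Δ, σ x = y) ∧
      (∀ r ∈ K, r ≠ p → ∀ u ∈ K, u ≠ p → u ≠ r → ∀ v ∈ K, v ≠ p → v ≠ r →
        ∃ σ ∈ Δ, σ r = r ∧ σ u = v)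

theorem HasStrains.exists_stabilizer (hS : L.HasStrains) {C : Set P} (hC : C ∈ L.Circles)
    {a : P} (ha : a ∈ C) : ∃ G, L.IsStrainStabilizer a C G := by
  obtain ⟨Δ, hAut, hFix, hPen, hA1, hA2⟩ := hS a C hC ha
  have stab : ∀ σ ∈ Δ, ∀ r ∈ C, r ≠ a → σ r ∈ C → ⇑σ '' C = C := by
    intro σ hσ r hr hra hσr
    rcases hPen σ hσ C (Set.mem_insert _ _) with h | ⟨-, h⟩
    · exact h
    · have hmem : σ r ∈ ⇑σ '' C ∩ C := ⟨⟨r, hr, rfl⟩, hσr⟩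
      rw [h] at hmem
      exact absurd (σ.injective (hmem.trans (hFix σ hσ a (par_refl a)).symm)) hra
  have hnp : ∀ r ∈ C, r ≠ a → ¬ L.Par a r := fun r hr hra h => hra (eq_of_par_s19 hC ha hr h).symm
  refine ⟨{ carrier := {σ | σ ∈ Δ ∧ ⇑σ '' C = C}
            mul_mem' := ?_
            one_mem' := ⟨Δ.one_mem, by simp⟩
            inv_mem' := ?_ }, hC, ha, fun σ h => hAut σ h.1, fun σ h => hFix σ h.1,
            fun σ h => h.2, ?_⟩
  · rintro σ τ ⟨hσ, hσC⟩ ⟨hτ, hτC⟩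
    refine ⟨Δ.mul_mem hσ hτ, ?_⟩
    rw [Equiv.Perm.coe_mul, Set.image_comp, hτC, hσC]
  · rintro σ ⟨hσ, hσC⟩
    refine ⟨Δ.inv_mem hσ, ?_⟩
    conv_lhs => rw [← hσC]
    rw [← Set.image_comp, ← Equiv.Perm.coe_mul, inv_mul_cancel]
    simp
  · intro r hr u hu r' hr' u' hu' hra hua hra' hua' hru hru'
    obtain ⟨σ, hσ, hσr⟩ := hA1 r r' (hnp r hr hra) (hnp r' hr' hra')
    have hσC := stab σ hσ r hr hra (hσr ▸ hr')
    have hσu : σ u ∈ C := hσC ▸ ⟨u, hu, rfl⟩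
    have hσua : σ u ≠ a := fun h =>
      hua (σ.injective (h.trans (hFix σ hσ a (par_refl a)).symm))
    have hσur : σ u ≠ r' := fun h => hru (σ.injective (hσr.trans h.symm))
    obtain ⟨τ, hτ, hτr, hτu⟩ := hA2 r' hr' hra' (σ u) hσu hσua hσur u' hu' hua' hru'.symm
    refine ⟨τ * σ, ⟨Δ.mul_mem hτ hσ, ?_⟩, by simp [hσr, hτr], by simp [hτu]⟩
    rw [Equiv.Perm.coe_mul, Set.image_comp, hσC, stab τ hτ r' hr' hra' (hτr.symm ▸ hr')]

namespace IsStrainStabilizer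

variable {a q : P} {C : Set P} {G : Subgroup (Equiv.Perm P)}

theorem apply_mem (hG : L.IsStrainStabilizer a C G) {g : Equiv.Perm P} (hg : g ∈ G) {z : P}
    (hz : z ∈ C) : g z ∈ C := by
  have h := hG.image_eq g hg
  exact h ▸ ⟨z, hz, rfl⟩

theorem apply_ne (hG : L.IsStrainStabilizer a C G) {g : Equiv.Perm P} (hg : g ∈ G) {z : P}
    (hz : z ≠ a) : g z ≠ a := fun h =>
  hz (g.injective (h.trans (hG.fix g hg a (par_refl a)).symm))

theorem tangentAt_image (hG : L.IsStrainStabilizer a C G) {g : Equiv.Perm P} (hg : g ∈ G)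
    {b : P} {M : Set P} (hM : L.TangentAt C b M) : L.TangentAt C (g b) (⇑g '' M) := by
  refine ⟨((hG.aut g hg).1 M).1 hM.1, ?_⟩
  conv_lhs => rw [← hG.image_eq g hg]
  rw [← Set.image_inter g.injective, hM.2, Set.image_singleton]

theorem par_apply (hG : L.IsStrainStabilizer a C G) {g : Equiv.Perm P} (hg : g ∈ G) {x y : P}
    (h : L.Par x y) : L.Par (g x) (g y) := ((hG.aut g hg).2 x y).1 h

/-- The image of a tangent circle, recognised by a point it contains. -/
theorem image_eq_of_mem (hG : L.IsStrainStabilizer a C G) {g : Equiv.Perm P} (hg : g ∈ G)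
    {b c z : P} {M N : Set P} (hM : L.TangentAt C b M) (hN : L.TangentAt C c N) (hbc : g b = c)
    (hz : z ∈ M) (hgz : g z = z) (hzN : z ∈ N) (hzC : z ∉ C) : ⇑g '' M = N := by
  have h := hG.tangentAt_image hg hM
  rw [hbc] at h
  exact h.unique hG.circle_mem hN ⟨z, hz, hgz⟩ hzN hzC

theorem fix_generator (hG : L.IsStrainStabilizer a C G) {g : Equiv.Perm P} (hg : g ∈ G)
    {b c y : P} (hb : b ∈ C) (hc : c ∈ C) (hca : c ≠ a) (hbc : b ≠ c) (hgb : g b = b)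
    (hgc : g c = c) (hy : L.Par b y) : g y = y := by
  by_cases hyC : y ∈ C
  · rwa [← eq_of_par_s19 hG.circle_mem hb hyC hy]
  obtain ⟨M, hM, hyM⟩ := exists_tangentAt hG.circle_mem hc hyC
    (fun h => hbc (eq_of_par_s19 hG.circle_mem hb hc (hy.trans h.symm)))
  obtain ⟨q, ⟨haq, hqM⟩, -⟩ := L.parPoint a M hM.1
  have hqC : q ∉ C := fun h => hca
    ((hM.eq_of_mem hqM h).symm.trans (eq_of_par_s19 hG.circle_mem hG.point_mem h haq).symm)
  have hgM := hG.image_eq_of_mem hg hM hM hgc hqM (hG.fix g hg q haq) hqM hqC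
  have hgy : g y ∈ M := hgM ▸ ⟨y, hyM, rfl⟩
  have hp := hG.par_apply hg hy
  rw [hgb] at hp
  exact eq_of_par_s19 hM.1 hgy hyM (hp.symm.trans hy)

/-- The group acts freely on ordered pairs of distinct points of `C ∖ {a}`. -/
theorem eq_one (hG : L.IsStrainStabilizer a C G) (haq : L.Par a q) (hq : q ∉ C)
    {g : Equiv.Perm P} (hg : g ∈ G) {b c : P} (hb : b ∈ C) (hc : c ∈ C) (hba : b ≠ a)
    (hca : c ≠ a) (hbc : b ≠ c) (hgb : g b = b) (hgc : g c = c) : g = 1 := by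
  have hC := hG.circle_mem
  have key : ∀ d ∈ C, g d = d := by
    intro d hd
    rcases eq_or_ne d a with rfl | hda
    · exact hG.fix g hg _ (par_refl _)
    rcases eq_or_ne d b with rfl | hdb
    · exact hgb
    rcases eq_or_ne d c with rfl | hdc
    · exact hgc
    obtain ⟨M, hM, hqM⟩ := exists_tangentAt hC hd hq
      (fun h => hda (eq_of_par_s19 hC hd hG.point_mem (h.trans haq.symm)))
    obtain ⟨b', ⟨hbb', hbM⟩, -⟩ := L.parPoint b M hM.1
    obtain ⟨c', ⟨hcc', hcM⟩, -⟩ := L.parPoint c M hM.1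
    have h1 : q ≠ b' := fun h =>
      hba (eq_of_par_s19 hC hb hG.point_mem (hbb'.trans (h ▸ haq.symm)))
    have h2 : q ≠ c' := fun h =>
      hca (eq_of_par_s19 hC hc hG.point_mem (hcc'.trans (h ▸ haq.symm)))
    have h3 : b' ≠ c' := fun h =>
      hbc (eq_of_par_s19 hC hb hc (hbb'.trans (h ▸ hcc'.symm)))
    have hgM : ⇑g '' M = M := eq_of_three (((hG.aut g hg).1 M).1 hM.1) hM.1 h1 h3 h2
      ⟨q, hqM, hG.fix g hg q haq⟩
      ⟨b', hbM, hG.fix_generator hg hb hc hca hbc hgb hgc hbb'⟩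
      ⟨c', hcM, hG.fix_generator hg hc hb hba hbc.symm hgc hgb hcc'⟩ hqM hbM hcM
    have ht := hG.tangentAt_image hg hM
    rw [hgM] at ht
    exact ht.point_unique hM
  ext z
  obtain ⟨d, ⟨hzd, hd⟩, -⟩ := L.parPoint z C hC
  rcases eq_or_ne d b with rfl | hdb
  · exact hG.fix_generator hg hd hc hca hbc hgb hgc hzd.symm
  · exact hG.fix_generator hg hd hb hba hdb (key d hd) hgb hzd.symm

theorem exists_swap (hG : L.IsStrainStabilizer a C G) {b c : P} (hb : b ∈ C) (hc : c ∈ C)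
    (hba : b ≠ a) (hca : c ≠ a) (hbc : b ≠ c) : ∃ σ ∈ G, σ b = c ∧ σ c = b :=
  hG.trans b hb c hc c hc b hb hba hca hca hba hbc hbc.symm

theorem swap_fix_inter (hG : L.IsStrainStabilizer a C G) (haq : L.Par a q) (hq : q ∉ C)
    {σ : Equiv.Perm P} (hσ : σ ∈ G) {b c y : P} {M N : Set P} (hM : L.TangentAt C b M)
    (hN : L.TangentAt C c N) (hbc : b ≠ c) (hσb : σ b = c) (hσc : σ c = b)
    (hqM : q ∈ M) (hqN : q ∈ N) (hyM : y ∈ M) (hyN : y ∈ N) (hyq : y ≠ q) : σ y = y := by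
  have hσq := hG.fix σ hσ q haq
  have hMN := hG.image_eq_of_mem hσ hM hN hσb hqM hσq hqN hq
  have hNM := hG.image_eq_of_mem hσ hN hM hσc hqN hσq hqM hq
  have h1 : σ y ∈ N := hMN ▸ ⟨y, hyM, rfl⟩
  have h2 : σ y ∈ M := hNM ▸ ⟨y, hyN, rfl⟩
  by_contra hne
  have h3 : q ≠ σ y := fun h => hyq (σ.injective (h.symm.trans hσq.symm))
  have := eq_of_three hM.1 hN.1 hyq.symm (Ne.symm hne) h3 hqM hyM h2 hqN hyN h1
  subst this
  exact hbc (hM.point_unique hN)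

/-- If `g` fixes `y` it fixes the point of `C` parallel to `y`. -/
theorem fix_base (hG : L.IsStrainStabilizer a C G) {g : Equiv.Perm P} (hg : g ∈ G) {m y : P}
    (hm : m ∈ C) (hmy : L.Par m y) (hy : g y = y) : g m = m := by
  have h := hG.par_apply hg hmy
  rw [hy] at h
  exact eq_of_par_s19 hG.circle_mem (hG.apply_mem hg hm) hm (h.trans hmy.symm)

theorem swap_fix_midpoint (hG : L.IsStrainStabilizer a C G) (hA : L.UniqueTangents)
    (haq : L.Par a q) (hq : q ∉ C) {σ : Equiv.Perm P} (hσ : σ ∈ G) {b c : P} {M : Set P}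
    (hM : L.TangentAt C b M) (hqM : q ∈ M) (hc : c ∈ C) (hca : c ≠ a)
    (hbc : b ≠ c) (hσb : σ b = c) (hσc : σ c = b) :
    ∃ m ∈ C, m ≠ a ∧ σ m = m ∧ ∃ y ∈ M, L.Par m y := by
  have hC := hG.circle_mem
  obtain ⟨N, hN, hqN⟩ := exists_tangentAt hC hc hq
      (fun h => hca (eq_of_par_s19 hC hc hG.point_mem (h.trans haq.symm)))
  obtain ⟨y, hyq, hyM, hyN⟩ := hA.exists_second hC hM hN hbc hqM hqN
  have hσy := hG.swap_fix_inter haq hq hσ hM hN hbc hσb hσc hqM hqN hyM hyN hyq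
  obtain ⟨m, ⟨hym, hm⟩, -⟩ := L.parPoint y C hC
  refine ⟨m, hm, ?_, hG.fix_base hσ hm hym.symm hσy, y, hyM, hym.symm⟩
  rintro rfl
  exact hyq (eq_of_par_s19 hM.1 hyM hqM (hym.trans haq))

theorem swap_fix_generator (hG : L.IsStrainStabilizer a C G) (hA : L.UniqueTangents)
    {σ : Equiv.Perm P} (hσ : σ ∈ G) {b c m y : P} (hb : b ∈ C) (hc : c ∈ C)
    (hba : b ≠ a) (hca : c ≠ a) (hbc : b ≠ c) (hσb : σ b = c) (hσc : σ c = b)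
    (hm : m ∈ C) (hma : m ≠ a) (hσm : σ m = m) (hmy : L.Par m y) : σ y = y := by
  have hC := hG.circle_mem
  by_cases hyC : y ∈ C
  · rwa [← eq_of_par_s19 hC hm hyC hmy]
  have hbm : b ≠ m := by
    rintro rfl
    exact hbc (hσm.symm.trans hσb)
  obtain ⟨M, hM, hyM⟩ := exists_tangentAt hC hb hyC
    (fun h => hbm (eq_of_par_s19 hC hb hm (h.trans hmy.symm)))
  obtain ⟨q, ⟨haq, hqM⟩, -⟩ := L.parPoint a M hM.1
  have hqC : q ∉ C := fun h => hba
    ((hM.eq_of_mem hqM h).symm.trans (eq_of_par_s19 hC hG.point_mem h haq).symm)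
  obtain ⟨N, hN, hqN⟩ := exists_tangentAt hC hc hqC
      (fun h => hca (eq_of_par_s19 hC hc hG.point_mem (h.trans haq.symm)))
  obtain ⟨z, hzq, hzM, hzN⟩ := hA.exists_second hC hM hN hbc hqM hqN
  have hσz := hG.swap_fix_inter haq hqC hσ hM hN hbc hσb hσc hqM hqN hzM hzN hzq
  obtain ⟨n, ⟨hzn, hn⟩, -⟩ := L.parPoint z C hC
  have hσn := hG.fix_base hσ hn hzn.symm hσz
  have hna : n ≠ a := by
    rintro rfl
    exact hzq (eq_of_par_s19 hM.1 hzM hqM (hzn.trans haq))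
  have hnm : n = m := by
    by_contra hne
    have := hG.eq_one haq hqC hσ hn hm hna hma hne hσn hσm
    subst this
    exact hbc hσb
  subst hnm
  rwa [eq_of_par_s19 hM.1 hyM hzM (hmy.symm.trans hzn.symm)]

/-- Any two points of `C ∖ {a}` are exchanged by a group element preserving all circles tangent
to `C` at `a`. -/
theorem exists_translation (hG : L.IsStrainStabilizer a C G) (hA : L.UniqueTangents)
    (haq : L.Par a q) (hq : q ∉ C) {b c : P} (hb : b ∈ C) (hc : c ∈ C)
    (hba : b ≠ a) (hca : c ≠ a) (hbc : b ≠ c) :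
    ∃ σ ∈ G, σ b = c ∧ ∀ H, L.TangentAt C a H → ⇑σ '' H = H := by
  have hC := hG.circle_mem
  obtain ⟨σ, hσ, hσb, hσc⟩ := hG.exists_swap hb hc hba hca hbc
  obtain ⟨M, hM, hqM⟩ := exists_tangentAt hC hb hq
      (fun h => hba (eq_of_par_s19 hC hb hG.point_mem (h.trans haq.symm)))
  obtain ⟨m, hm, hma, hσm, -⟩ :=
    hG.swap_fix_midpoint hA haq hq hσ hM hqM hc hca hbc hσb hσc
  refine ⟨σ, hσ, hσb, fun H hH => ?_⟩
  obtain ⟨h, ⟨hmh, hh⟩, -⟩ := L.parPoint m H hH.1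
  have hhC : h ∉ C := fun h' =>
    hma ((eq_of_par_s19 hC hm h' hmh).trans (hH.eq_of_mem hh h'))
  exact hG.image_eq_of_mem hσ hH hH (hG.fix σ hσ a (par_refl a)) hh
    (hG.swap_fix_generator hA hσ hb hc hba hca hbc hσb hσc hm hma hσm hmh) hh hhC

/-- A tangent circle through `q` and `y` comes with a second one. -/
theorem exists_second_tangent (hG : L.IsStrainStabilizer a C G) (hA : L.UniqueTangents)
    (haq : L.Par a q) (hq : q ∉ C) {b y : P} {M : Set P} (hM : L.TangentAt C b M)
    (hqM : q ∈ M) (hyM : y ∈ M) (hyq : y ≠ q) (hy : y ∉ C) :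
    ∃ c N, c ≠ b ∧ L.TangentAt C c N ∧ q ∈ N ∧ y ∈ N := by
  have hC := hG.circle_mem
  have hb := hM.mem_base
  have hba : b ≠ a := by
    rintro rfl
    exact hM.not_par hqM hq haq
  obtain ⟨m, ⟨hym, hm⟩, -⟩ := L.parPoint y C hC
  have hma : m ≠ a := by
    rintro rfl
    exact hyq (eq_of_par_s19 hM.1 hyM hqM (hym.trans haq))
  have hbm : b ≠ m := by
    rintro rfl
    exact hM.not_par hyM hy hym.symm
  obtain ⟨σ, hσ, hσb, hσm⟩ := hG.exists_swap hb hm hba hma hbm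
  obtain ⟨n, hn, hna, hσn, -⟩ :=
    hG.swap_fix_midpoint hA haq hq hσ hM hqM hm hma hbm hσb hσm
  have hbn : b ≠ n := by
    rintro rfl
    exact hbm (hσn.symm.trans hσb)
  obtain ⟨g, hg, hgn, -⟩ := hG.trans n hn b hb m hm b hb hna hba hma hba hbn.symm hbm.symm
  have hτ : g * σ * g⁻¹ ∈ G := G.mul_mem (G.mul_mem hg hσ) (G.inv_mem hg)
  have hτm : (g * σ * g⁻¹) m = m := by simp [← hgn, hσn]
  have hgbm : g b ≠ g m := fun h => hbm (g.injective h)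
  have hτ1 : (g * σ * g⁻¹) (g b) = g m := by simp [hσb]
  have hτ2 : (g * σ * g⁻¹) (g m) = g b := by simp [hσm]
  generalize g * σ * g⁻¹ = τ at *
  have hτy := hG.swap_fix_generator hA hτ (hG.apply_mem hg hb) (hG.apply_mem hg hm)
    (hG.apply_ne hg hba) (hG.apply_ne hg hma) hgbm hτ1 hτ2 hm hma hτm hym.symm
  refine ⟨τ b, ⇑τ '' M, fun h => ?_, hG.tangentAt_image hτ hM,
    ⟨q, hqM, hG.fix τ hτ q haq⟩, ⟨y, hyM, hτy⟩⟩
  have := hG.eq_one haq hq hτ hb hm hba hma hbm h hτm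
  subst this
  exact hgbm hτ1

/-- There are at most two circles through `q` and `y` tangent to `C`. -/
theorem third_tangent_eq (hG : L.IsStrainStabilizer a C G) (haq : L.Par a q) (hq : q ∉ C)
    {b c d y : P} {M N K : Set P} (hM : L.TangentAt C b M) (hN : L.TangentAt C c N)
    (hK : L.TangentAt C d K) (hqM : q ∈ M) (hqN : q ∈ N) (hqK : q ∈ K) (hyM : y ∈ M)
    (hyN : y ∈ N) (hyK : y ∈ K) (hyq : y ≠ q) (hy : y ∉ C) (hbc : b ≠ c) (hbd : b ≠ d) :
    c = d := by
  have hC := hG.circle_mem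
  have hne : ∀ {e : P} {A : Set P}, L.TangentAt C e A → q ∈ A → e ≠ a := by
    rintro e A hA hqA rfl
    exact hA.not_par hqA hq haq
  have hba := hne hM hqM
  have hca := hne hN hqN
  have hda := hne hK hqK
  have hb := hM.mem_base
  have hc := hN.mem_base
  have hd := hK.mem_base
  obtain ⟨m, ⟨hym, hm⟩, -⟩ := L.parPoint y C hC
  have hma : m ≠ a := by
    rintro rfl
    exact hyq (eq_of_par_s19 hM.1 hyM hqM (hym.trans haq))
  have hbm : b ≠ m := by
    rintro rfl
    exact hM.not_par hyM hy hym.symm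
  obtain ⟨σ, hσ, hσb, hσc⟩ := hG.exists_swap hb hc hba hca hbc
  obtain ⟨τ, hτ, hτb, hτd⟩ := hG.exists_swap hb hd hba hda hbd
  have hσm := hG.fix_base hσ hm hym.symm
    (hG.swap_fix_inter haq hq hσ hM hN hbc hσb hσc hqM hqN hyM hyN hyq)
  have hτm := hG.fix_base hτ hm hym.symm
    (hG.swap_fix_inter haq hq hτ hM hK hbd hτb hτd hqM hqK hyM hyK hyq)
  obtain ⟨g, hg, hgb, hgc⟩ := hG.trans b hb c hc b hb d hd hba hca hba hda hbc hbd
  have hgb' : g⁻¹ b = b := by rw [Equiv.Perm.inv_eq_iff_eq, hgb]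
  have hgd' : g⁻¹ d = c := by rw [Equiv.Perm.inv_eq_iff_eq, hgc]
  have hτb' : τ⁻¹ d = b := by rw [Equiv.Perm.inv_eq_iff_eq, hτb]
  have hτd' : τ⁻¹ b = d := by rw [Equiv.Perm.inv_eq_iff_eq, hτd]
  have h1 : τ⁻¹ * (g * σ * g⁻¹) = 1 :=
    hG.eq_one haq hq (G.mul_mem (G.inv_mem hτ) (G.mul_mem (G.mul_mem hg hσ) (G.inv_mem hg)))
      hb hd hba hda hbd
      (by simp only [Equiv.Perm.mul_apply, hgb', hσb, hgc, hτb'])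
      (by simp only [Equiv.Perm.mul_apply, hgd', hσc, hgb, hτd'])
  have h2 : τ * g = g * σ := by
    rw [inv_mul_eq_one] at h1
    rw [h1]; group
  have h3 : τ (g m) = g m := by
    have := congrArg (fun f : Equiv.Perm P => f m) h2
    simpa [hσm] using this
  have hgm : g m = m := by
    by_contra h
    have := hG.eq_one haq hq hτ (hG.apply_mem hg hm) hm (hG.apply_ne hg hma) hma h h3 hτm
    subst this
    exact hbd hτb
  have := hG.eq_one haq hq hg hb hm hba hma hbm hgb hgm
  subst this
  exact hgc

end IsStrainStabilizer

/-- Some circle tangent to `C` contains both `x` and `y`. -/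
def Cotangent (L : LaguerrePlane P) (C : Set P) (x y : P) : Prop :=
  ∃ b M, L.TangentAt C b M ∧ x ∈ M ∧ y ∈ M

theorem Cotangent.trans (hS : L.HasStrains) (hA : L.UniqueTangents) {C : Set P}
    (hC : C ∈ L.Circles) {x y z : P} (hx : x ∉ C) (hy : y ∉ C) (hz : z ∉ C)
    (hxy : ¬ L.Par x y) (hxz : L.Cotangent C x z) (hzy : L.Cotangent C z y) :
    L.Cotangent C x y := by
  rcases eq_or_ne z y with rfl | hne
  · exact hxz
  rcases eq_or_ne z x with rfl | hne'
  · exact hzy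
  obtain ⟨c, M, hM, hxM, hzM⟩ := hxz
  obtain ⟨b, N, hN, hzN, hyN⟩ := hzy
  obtain ⟨a, ⟨hxa, ha⟩, -⟩ := L.parPoint x C hC
  obtain ⟨z', ⟨hzz', hz'⟩, -⟩ := L.parPoint z C hC
  obtain ⟨y', ⟨hyy', hy'⟩, -⟩ := L.parPoint y C hC
  obtain ⟨G, hG⟩ := hS.exists_stabilizer hC ha
  have hz'a : z' ≠ a := by
    rintro rfl
    exact hne' (eq_of_par_s19 hM.1 hzM hxM (hzz'.trans hxa.symm))
  have hy'a : y' ≠ a := by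
    rintro rfl
    exact hxy (hxa.trans hyy'.symm)
  have hzy' : z' ≠ y' := by
    rintro rfl
    exact hne (eq_of_par_s19 hN.1 hzN hyN (hzz'.trans hyy'.symm))
  have key : ∃ g ∈ G, g z' = y' ∧ ⇑g '' N = N := by
    rcases eq_or_ne b a with rfl | hba
    · obtain ⟨σ, hσ, hσz, hσH⟩ :=
        hG.exists_translation hA hxa.symm hx hz' hy' hz'a hy'a hzy'
      exact ⟨σ, hσ, hσz, hσH N hN⟩
    · obtain ⟨q, ⟨haq, hqN⟩, -⟩ := L.parPoint a N hN.1
      have hqC : q ∉ C := fun h => hba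
        ((hN.eq_of_mem hqN h).symm.trans (eq_of_par_s19 hC ha h haq).symm)
      have h1 : b ≠ z' := by
        rintro rfl
        exact hN.not_par hzN hz hzz'.symm
      have h2 : b ≠ y' := by
        rintro rfl
        exact hN.not_par hyN hy hyy'.symm
      obtain ⟨g, hg, hgb, hgz⟩ := hG.trans b hN.mem_base z' hz' b hN.mem_base y' hy'
        hba hz'a hba hy'a h1 h2
      exact ⟨g, hg, hgz, hG.image_eq_of_mem hg hN hN hgb hqN (hG.fix g hg q haq) hqN hqC⟩
  obtain ⟨g, hg, hgz, hgN⟩ := key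
  have hgzN : g z ∈ N := hgN ▸ ⟨z, hzN, rfl⟩
  have hp := hG.par_apply hg hzz'
  rw [hgz] at hp
  exact ⟨g c, ⇑g '' M, hG.tangentAt_image hg hM, ⟨x, hxM, hG.fix g hg x hxa.symm⟩,
    ⟨z, hzM, eq_of_par_s19 hN.1 hgzN hyN (hp.trans hyy'.symm)⟩⟩

theorem Cotangent.inter_nonempty (hS : L.HasStrains) (hA : L.UniqueTangents) {C : Set P}
    (hC : C ∈ L.Circles) {x y a b : P} {M N : Set P} (hx : x ∉ C) (hy : y ∉ C)
    (hxy : L.Cotangent C x y) (hM : L.TangentAt C a M) (hN : L.TangentAt C b N)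
    (hxM : x ∈ M) (hyN : y ∈ N) : (M ∩ N).Nonempty := by
  rcases eq_or_ne b a with rfl | hba
  · exact ⟨b, hM.mem, hN.mem⟩
  have ha := hM.mem_base
  obtain ⟨G, hG⟩ := hS.exists_stabilizer hC ha
  obtain ⟨q, ⟨haq, hqN⟩, -⟩ := L.parPoint a N hN.1
  have hqC : q ∉ C := fun h => hba
    ((hN.eq_of_mem hqN h).symm.trans (eq_of_par_s19 hC ha h haq).symm)
  obtain ⟨c, K, hK, hxK, hqK⟩ := Cotangent.trans hS hA hC hx hqC hy
    (fun h => hM.not_par hxM hx (haq.trans h.symm)) hxy ⟨b, N, hN, hyN, hqN⟩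
  have hca : c ≠ a := by
    rintro rfl
    exact hK.not_par hqK hqC haq
  rcases eq_or_ne c b with rfl | hcb
  · exact ⟨x, hxM, hK.unique hC hN hqK hqN hqC ▸ hxK⟩
  obtain ⟨σ, hσ, hσc, hσH⟩ :=
    hG.exists_translation hA haq hqC hK.mem_base hN.mem_base hca hba hcb
  have hKN := hG.image_eq_of_mem hσ hK hN hσc hqK (hG.fix σ hσ q haq) hqN hqC
  refine ⟨σ x, ?_, hKN ▸ ⟨x, hxK, rfl⟩⟩
  have hMM := hσH M hM
  exact hMM ▸ ⟨x, hxM, rfl⟩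

/-- Any two points of a circle are avoided by some third one. -/
theorem exists_mem_ne_ne {C : Set P} (hC : C ∈ L.Circles) (u v : P) :
    ∃ c ∈ C, c ≠ u ∧ c ≠ v := by
  obtain ⟨K, hK, ⟨a, b, c, ha, hb, hc, hab, hbc, hac⟩, -⟩ := L.nontriv
  obtain ⟨a', ⟨haa', ha'⟩, -⟩ := L.parPoint a C hC
  obtain ⟨b', ⟨hbb', hb'⟩, -⟩ := L.parPoint b C hC
  obtain ⟨c', ⟨hcc', hc'⟩, -⟩ := L.parPoint c C hC
  have h1 : a' ≠ b' := by
    rintro rfl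
    exact hab (eq_of_par_s19 hK ha hb (haa'.trans hbb'.symm))
  have h2 : b' ≠ c' := by
    rintro rfl
    exact hbc (eq_of_par_s19 hK hb hc (hbb'.trans hcc'.symm))
  have h3 : a' ≠ c' := by
    rintro rfl
    exact hac (eq_of_par_s19 hK ha hc (haa'.trans hcc'.symm))
  by_contra! h
  have := h a' ha'
  have := h b' hb'
  have := h c' hc'
  by_cases a' = u <;> by_cases b' = u <;> grind

end LaguerrePlane

/-- if every pencil of the Laguerre plane admits a transitive
strain group and satisfies (A3), then for nonparallel points x, y and a circle
C avoiding them the three tangency conditions are equivalent. -/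
theorem two_tangent_circles_tfae
    {P : Type*} (L : LaguerrePlane P)
    (hΔ : ∀ (p : P) (K : Set P), K ∈ L.Circles → p ∈ K →
      ∃ Δ : Subgroup (Equiv.Perm P),
        (∀ σ ∈ Δ, L.IsAut σ) ∧
        (∀ σ ∈ Δ, ∀ q, L.Par p q → σ q = q) ∧
        (∀ σ ∈ Δ, ∀ M ∈ L.pencil p K, ⇑σ '' M ∈ L.pencil p K) ∧
        (∀ x y : P, ¬ L.Par p x → ¬ L.Par p y → ∃ σ ∈ Δ, σ x = y) ∧
        (∀ r ∈ K, r ≠ p → ∀ u ∈ K, u ≠ p → u ≠ r → ∀ v ∈ K, v ≠ p → v ≠ r →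
          ∃ σ ∈ Δ, σ r = r ∧ σ u = v))
    (hA3 : ∀ (p : P) (K : Set P), K ∈ L.Circles → p ∈ K →
      ∀ M ∈ L.Circles, p ∉ M → ∃! N, N ∈ L.pencil p K ∧ ∃ z, M ∩ N = {z}) :
    ∀ x y : P, ¬ L.Par x y → ∀ C ∈ L.Circles, x ∉ C → y ∉ C →
    -- (1) ↔ (2)
    (((∃ M N : Set P, M ≠ N ∧
        (M ∈ L.Circles ∧ x ∈ M ∧ y ∈ M ∧ ∃ z, M ∩ C = {z}) ∧
        (N ∈ L.Circles ∧ x ∈ N ∧ y ∈ N ∧ ∃ z, N ∩ C = {z}) ∧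
        (∀ M' : Set P,
          (M' ∈ L.Circles ∧ x ∈ M' ∧ y ∈ M' ∧ ∃ z, M' ∩ C = {z}) →
          M' = M ∨ M' = N)) ↔ tangentEquiv L C x y) ∧
    -- (2) ↔ (3)
     (tangentEquiv L C x y ↔
       ∃ M ∈ L.Circles, ∃ N ∈ L.Circles, ∃ a b : P,
         M ∩ C = {a} ∧ N ∩ C = {b} ∧ a ≠ b ∧ x ∈ M ∧ y ∈ N ∧
         (M ∩ N).Nonempty)) := by
  intro x y hxy C hC hx hy
  have hS : L.HasStrains := hΔ
  have hA : L.UniqueTangents := hA3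
  have h12 : L.Cotangent C x y → tangentEquiv L C x y := by
    rintro h M hM N hN hxM hyN ⟨a, ha⟩ ⟨b, hb⟩
    exact h.inter_nonempty hS hA hC hx hy ⟨hM, ha⟩ ⟨hN, hb⟩ hxM hyN
  have h23 : tangentEquiv L C x y → ∃ M ∈ L.Circles, ∃ N ∈ L.Circles, ∃ a b : P,
      M ∩ C = {a} ∧ N ∩ C = {b} ∧ a ≠ b ∧ x ∈ M ∧ y ∈ N ∧ (M ∩ N).Nonempty := by
    intro h
    obtain ⟨x', ⟨hxx', hx'⟩, -⟩ := L.parPoint x C hC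
    obtain ⟨y', ⟨hyy', hy'⟩, -⟩ := L.parPoint y C hC
    obtain ⟨a, ha, hax, -⟩ := exists_mem_ne_ne hC x' x'
    obtain ⟨b, hb, hby, hba⟩ := exists_mem_ne_ne hC y' a
    obtain ⟨M, hM, hxM⟩ := exists_tangentAt hC ha hx
      (fun h => hax (eq_of_par_s19 hC ha hx' (h.trans hxx')))
    obtain ⟨N, hN, hyN⟩ := exists_tangentAt hC hb hy
      (fun h => hby (eq_of_par_s19 hC hb hy' (h.trans hyy')))
    exact ⟨M, hM.1, N, hN.1, a, b, hM.2, hN.2, hba.symm, hxM, hyN,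
      h M hM.1 N hN.1 hxM hyN ⟨a, hM.2⟩ ⟨b, hN.2⟩⟩
  have h3 : (∃ M ∈ L.Circles, ∃ N ∈ L.Circles, ∃ a b : P,
      M ∩ C = {a} ∧ N ∩ C = {b} ∧ a ≠ b ∧ x ∈ M ∧ y ∈ N ∧ (M ∩ N).Nonempty) →
      L.Cotangent C x y := by
    rintro ⟨M, hM, N, hN, a, b, ha, hb, hab, hxM, hyN, z, hzM, hzN⟩
    have hMt : L.TangentAt C a M := ⟨hM, ha⟩
    have hNt : L.TangentAt C b N := ⟨hN, hb⟩
    have hz : z ∉ C := fun h =>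
      hab ((hMt.eq_of_mem hzM h).symm.trans (hNt.eq_of_mem hzN h))
    exact Cotangent.trans hS hA hC hx hy hz hxy ⟨a, M, hMt, hxM, hzM⟩ ⟨b, N, hNt, hzN, hyN⟩
  refine ⟨⟨?_, fun h => ?_⟩, h23, fun h => h12 (h3 h)⟩
  · rintro ⟨M, -, -, ⟨hM, hxM, hyM, a, ha⟩, -⟩
    exact h12 ⟨a, M, ⟨hM, ha⟩, hxM, hyM⟩
  · obtain ⟨b, M, hM, hxM, hyM⟩ := h3 (h23 h)
    obtain ⟨a, ⟨hxa, ha⟩, -⟩ := L.parPoint x C hC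
    obtain ⟨G, hG⟩ := hS.exists_stabilizer hC ha
    have hyx : y ≠ x := by
      rintro rfl
      exact hxy (par_refl y)
    obtain ⟨c, N, hcb, hN, hxN, hyN⟩ :=
      hG.exists_second_tangent hA hxa.symm hx hM hxM hyM hyx hy
    refine ⟨M, N, ?_, ⟨hM.1, hxM, hyM, b, hM.2⟩, ⟨hN.1, hxN, hyN, c, hN.2⟩, ?_⟩
    · rintro rfl
      exact hcb (hN.point_unique hM)
    · rintro K ⟨hK, hxK, hyK, d, hd⟩
      have hKt : L.TangentAt C d K := ⟨hK, hd⟩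
      rcases eq_or_ne b d with rfl | hbd
      · exact Or.inl (hKt.unique hC hM hxK hxM hx)
      · have := hG.third_tangent_eq hxa.symm hx hM hN hKt hxM hxN hxK hyM hyN hyK hyx hy
          hcb.symm hbd
        subst this
        exact Or.inr (hKt.unique hC hN hxK hxN hx)
end
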